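/- Let G be a finite edge-weighted graph that can be (s,t)-covered. If all edge weights of G are positive, then f(G; n) ≲ n^((4/3)s + 2t), i.e., there is a constant C such that every set of n points in ℝ² contains at most C · n^((4/3)s + 2t) distance G-configurations. If all edge weights of G are nonzero, then g(G; n) ≲ n^((4/3)s + 2t), i.e., there is a constant C such that every set of n points in ℝ² contains at most C · n^((4/3)s + 2t) dot product G-configurations. -/

import Mathlib

open scoped InnerProductSpace

noncomputable section

/-- Points in the plane. -/
abbrev Pt2 : Type := EuclideanSpace ℝ (Fin 2)

/-- A graph `G` can be `(s, t)`-covered if its vertex set can be partitioned into the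
vertex sets of `s` pairwise vertex-disjoint copies of the path `P₂` (single edges) and
`t` pairwise vertex-disjoint copies of the path `P₃`, all of whose edges are edges of
`G`.  We encode such a partition as a bijection from `Fin s × Fin 2 ⊕ Fin t × Fin 3`
onto the vertices, respecting adjacency along each path. -/
def IsSTCovered {V : Type*} (G : SimpleGraph V) (s t : ℕ) : Prop :=
  ∃ F : (Fin s × Fin 2) ⊕ (Fin t × Fin 3) → V, Function.Bijective F ∧
    (∀ i : Fin s, G.Adj (F (Sum.inl (i, 0))) (F (Sum.inl (i, 1)))) ∧
    (∀ j : Fin t, G.Adj (F (Sum.inr (j, 0))) (F (Sum.inr (j, 1))) ∧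
      G.Adj (F (Sum.inr (j, 1))) (F (Sum.inr (j, 2))))

/-- The set of distance `G`-configurations in a point set `E`, for a graph `G` with
edge-weight function `w`: injective maps `φ` from the vertices of `G` into `E` such that
the distance between the images of any two adjacent vertices equals the weight of the
corresponding edge. -/
def distConfigs {V : Type*} (G : SimpleGraph V) (w : V → V → ℝ) (E : Finset Pt2) :
    Set (V → Pt2) :=
  {φ | (∀ v, φ v ∈ E) ∧ Function.Injective φ ∧ ∀ u v, G.Adj u v → ‖φ u - φ v‖ = w u v}

/-- The set of dot product `G`-configurations in a point set `E`, for a graph `G` with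
edge-weight function `w`: injective maps `φ` from the vertices of `G` into `E` such that
the dot product of the images of any two adjacent vertices equals the weight of the
corresponding edge. -/
def dpConfigs {V : Type*} (G : SimpleGraph V) (w : V → V → ℝ) (E : Finset Pt2) :
    Set (V → Pt2) :=
  {φ | (∀ v, φ v ∈ E) ∧ Function.Injective φ ∧ ∀ u v, G.Adj u v → ⟪φ u, φ v⟫_ℝ = w u v}

/-- A plane drawing of a simple graph by `x`-monotone arcs: vertices `v` sit at `(X v, Y v)`,
and an edge `e` is the graph of `f e` over the interval from its left to its right endpoint.
No vertex lies in the interior of an arc, and interiors of distinct arcs are disjoint. -/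
structure PlaneArcs (V ε : Type*) where
  X : V → ℝ
  Y : V → ℝ
  left : ε → V
  right : ε → V
  f : ε → ℝ → ℝ
  pos_inj : ∀ a b, X a = X b → Y a = Y b → a = b
  lt : ∀ e, X (left e) < X (right e)
  f_left : ∀ e, f e (X (left e)) = Y (left e)
  f_right : ∀ e, f e (X (right e)) = Y (right e)
  cont : ∀ e, ContinuousOn (f e) (Set.Icc (X (left e)) (X (right e)))
  avoid : ∀ e v, X (left e) < X v → X v < X (right e) → f e (X v) ≠ Y v
  noncrossing : ∀ e e', e ≠ e' → ∀ x, X (left e) < x → x < X (right e) →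
    X (left e') < x → x < X (right e') → f e x ≠ f e' x
  simple : ∀ e e', left e = left e' → right e = right e' → e = e'

namespace PlaneArcs

variable {V ε : Type*} (A : PlaneArcs V ε)

/-- `A.Over e x` says that `x` lies strictly between the abscissae of the endpoints of `e`. -/
def Over (e : ε) (x : ℝ) : Prop := A.X (A.left e) < x ∧ x < A.X (A.right e)

/-- `A.Below a b` says that the arc `a` runs below the arc `b` somewhere, hence everywhere,
over their common range. -/
def Below (a b : ε) : Prop := ∃ x, A.Over a x ∧ A.Over b x ∧ A.f a x < A.f b x

variable {A}

theorem Below.ne {a b : ε} (h : A.Below a b) : a ≠ b := by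
  rintro rfl
  obtain ⟨x, -, -, h⟩ := h
  exact lt_irrefl _ h

theorem Below.le {a b : ε} (h : A.Below a b) {z : ℝ}
    (ha₁ : A.X (A.left a) ≤ z) (ha₂ : z ≤ A.X (A.right a))
    (hb₁ : A.X (A.left b) ≤ z) (hb₂ : z ≤ A.X (A.right b)) : A.f a z ≤ A.f b z := by
  have hne := h.ne
  obtain ⟨x, ⟨hxa₁, hxa₂⟩, ⟨hxb₁, hxb₂⟩, hx⟩ := h
  by_contra! hz
  have hsub : ∀ y ∈ Set.uIcc x z, (A.X (A.left a) ≤ y ∧ y ≤ A.X (A.right a)) ∧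
      (A.X (A.left b) ≤ y ∧ y ≤ A.X (A.right b)) := by
    intro y hy
    rcases Set.mem_uIcc.1 hy with hy | hy <;> refine ⟨⟨?_, ?_⟩, ⟨?_, ?_⟩⟩ <;> linarith [hy.1, hy.2]
  have hc : ContinuousOn (fun y => A.f b y - A.f a y) (Set.uIcc x z) :=
    ((A.cont b).mono fun y hy => (hsub y hy).2).sub ((A.cont a).mono fun y hy => (hsub y hy).1)
  have h0 : (0 : ℝ) ∈ Set.uIcc (A.f b x - A.f a x) (A.f b z - A.f a z) :=
    Set.mem_uIcc.2 (Or.inr ⟨by linarith, by linarith⟩)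
  obtain ⟨y, hy, hy0⟩ := intermediate_value_uIcc hc h0
  have hy0 : A.f b y - A.f a y = 0 := hy0
  have hyx : y ≠ x := by rintro rfl; linarith
  have hyz : y ≠ z := by rintro rfl; linarith
  have key : A.Over a y ∧ A.Over b y := by
    rcases Set.mem_uIcc.1 hy with hy | hy
    · have h1 : y < z := lt_of_le_of_ne hy.2 hyz
      refine ⟨⟨?_, ?_⟩, ⟨?_, ?_⟩⟩ <;> linarith [hy.1]
    · have h1 : z < y := lt_of_le_of_ne hy.1 (Ne.symm hyz)
      refine ⟨⟨?_, ?_⟩, ⟨?_, ?_⟩⟩ <;> linarith [hy.2]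
  exact A.noncrossing a b hne y key.1.1 key.1.2 key.2.1 key.2.2 (by linarith)

theorem Below.lt {a b : ε} (h : A.Below a b) {z : ℝ} (ha : A.Over a z) (hb : A.Over b z) :
    A.f a z < A.f b z :=
  lt_of_le_of_ne (h.le ha.1.le ha.2.le hb.1.le hb.2.le)
    (A.noncrossing a b h.ne z ha.1 ha.2 hb.1 hb.2)

theorem below_or_below {a b : ε} (hab : a ≠ b) {x : ℝ} (ha : A.Over a x) (hb : A.Over b x) :
    A.Below a b ∨ A.Below b a :=
  (lt_or_gt_of_ne (A.noncrossing a b hab x ha.1 ha.2 hb.1 hb.2)).imp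
    (fun h => ⟨x, ha, hb, h⟩) fun h => ⟨x, hb, ha, h⟩

theorem below_of_lt {a b : ε} {z : ℝ} (ha₁ : A.X (A.left a) < z) (ha₂ : z ≤ A.X (A.right a))
    (hb₁ : A.X (A.left b) < z) (hb₂ : z ≤ A.X (A.right b)) (h : A.f a z < A.f b z) :
    A.Below a b := by
  obtain ⟨x, hx, hxz⟩ := exists_between (max_lt ha₁ hb₁)
  have hab : a ≠ b := by rintro rfl; exact lt_irrefl _ h
  have hxa := (le_max_left _ _).trans_lt hx
  have hxb := (le_max_right _ _).trans_lt hx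
  refine (below_or_below hab ⟨hxa, by linarith⟩ ⟨hxb, by linarith⟩).resolve_right fun hba => ?_
  exact (hba.le hb₁.le hb₂ ha₁.le ha₂).not_gt h

theorem exists_over_of_left_eq {a b : ε} (h : A.left a = A.left b) :
    ∃ x, A.Over a x ∧ A.Over b x := by
  obtain ⟨x, h₁, h₂⟩ := exists_between (lt_min (A.lt a) (h ▸ A.lt b))
  exact ⟨x, ⟨h₁, h₂.trans_le (min_le_left _ _)⟩, ⟨h ▸ h₁, h₂.trans_le (min_le_right _ _)⟩⟩

theorem exists_over_of_right_eq {a b : ε} (h : A.right a = A.right b) :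
    ∃ x, A.Over a x ∧ A.Over b x := by
  obtain ⟨x, h₁, h₂⟩ := exists_between (max_lt (A.lt a) (h ▸ A.lt b))
  exact ⟨x, ⟨(le_max_left _ _).trans_lt h₁, h₂⟩, ⟨(le_max_right _ _).trans_lt h₁, h ▸ h₂⟩⟩

/-- An arc squeezed between two arcs emanating from `u` can only extend as far left as `u`. -/
theorem left_eq_of_squeeze {e h k : ε} (hl : A.left h = A.left e) (hek : A.Below e k)
    (hkh : A.Below k h) (hk : A.X (A.left k) ≤ A.X (A.left e)) : A.left k = A.left e := by
  have hr : A.X (A.left e) < A.X (A.right k) := by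
    obtain ⟨x, hxe, hxk, -⟩ := hek
    exact hxe.1.trans hxk.2
  have h₁ := hek.le le_rfl (A.lt e).le hk hr.le
  have h₂ := hkh.le hk hr.le (by rw [hl]) (by rw [← hl]; exact (A.lt h).le)
  have h₃ := A.f_left h
  rw [hl] at h₃
  rw [h₃] at h₂
  rw [A.f_left e] at h₁
  have hY : A.f k (A.X (A.left e)) = A.Y (A.left e) := le_antisymm h₂ h₁
  rcases hk.lt_or_eq with hlt | heq
  · exact absurd hY (A.avoid k _ hlt hr)
  · refine A.pos_inj _ _ heq ?_
    rw [← A.f_left k, heq, hY]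

variable (A) in
/-- `A.Sees v e` says that `e` is the arc directly below the vertex `v`. -/
def Sees (v : V) (e : ε) : Prop :=
  A.Over e (A.X v) ∧ A.f e (A.X v) < A.Y v ∧
    ∀ k, A.Over k (A.X v) → A.f e (A.X v) < A.f k (A.X v) → ¬ A.f k (A.X v) < A.Y v

theorem Sees.unique {v : V} {a b : ε} (ha : A.Sees v a) (hb : A.Sees v b) : a = b := by
  by_contra hab
  rcases lt_or_gt_of_ne (A.noncrossing a b hab _ ha.1.1 ha.1.2 hb.1.1 hb.1.2) with h | h
  · exact ha.2.2 b hb.1 h hb.2.1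
  · exact hb.2.2 a ha.1 h ha.2.1

/-- An arc that is neither the topmost one at its left endpoint nor the topmost one at its right
endpoint is seen by some vertex above it. -/
theorem exists_sees [Finite V] [Finite ε] {e h₀ e' : ε} (hl₀ : A.left h₀ = A.left e)
    (hb₀ : A.Below e h₀) (hr' : A.right e' = A.right e) (hb' : A.Below e e') :
    ∃ v, A.Sees v e := by
  classical
  obtain ⟨x₀, hx₀, hx₀r⟩ : ∃ x₀, A.X (A.left e) < x₀ ∧
      ∀ k, A.left k = A.left e → x₀ < A.X (A.right k) := by
    have h₁ : ∀ᶠ x in nhdsWithin (A.X (A.left e)) (Set.Ioi (A.X (A.left e))),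
        ∀ k, A.left k = A.left e → x < A.X (A.right k) := by
      refine Filter.eventually_all.2 fun k => ?_
      by_cases hk : A.left k = A.left e
      · have := Ioo_mem_nhdsGT (hk ▸ A.lt k : A.X (A.left e) < A.X (A.right k))
        filter_upwards [this] with x hx _ using hx.2
      · exact Filter.Eventually.of_forall fun x hk' => absurd hk' hk
    obtain ⟨x, hx, hx'⟩ := (h₁.and self_mem_nhdsWithin).exists
    exact ⟨x, hx', hx⟩
  have hover : ∀ k, A.left k = A.left e → A.Over k x₀ := fun k hk =>
    ⟨by rw [hk]; exact hx₀, hx₀r k hk⟩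
  obtain ⟨h, ⟨hl, hb⟩, hmin⟩ := Set.exists_min_image {k | A.left k = A.left e ∧ A.Below e k}
    (fun k => A.f k x₀) (Set.toFinite _) ⟨h₀, hl₀, hb₀⟩
  have hXl : A.X (A.left h) = A.X (A.left e) := by rw [hl]
  have hXr : A.X (A.right e') = A.X (A.right e) := by rw [hr']
  have squeeze : ∀ k, A.Below e k → A.Below k h → A.X (A.left e) < A.X (A.left k) := by
    intro k hek hkh
    by_contra! hk
    have hlk := left_eq_of_squeeze hl hek hkh hk
    exact (hmin k ⟨hlk, hek⟩).not_gt (hkh.lt (hover k hlk) (hover h hl))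
  let T : Set V := {v | A.Over e (A.X v) ∧ A.f e (A.X v) < A.Y v ∧ A.X v ≤ A.X (A.right h) ∧
    A.Y v ≤ A.f h (A.X v)}
  have left_mem : ∀ k, A.Below e k → A.Below k h → A.left k ∈ T := by
    intro k hek hkh
    have h₁ := squeeze k hek hkh
    have h₂ : A.X (A.left k) < A.X (A.right e) := by
      obtain ⟨x, hxe, hxk, -⟩ := hek
      exact hxk.1.trans hxe.2
    have h₃ : A.X (A.left k) < A.X (A.right h) := by
      obtain ⟨x, hxk, hxh, -⟩ := hkh
      exact hxk.1.trans hxh.2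
    refine ⟨⟨h₁, h₂⟩, lt_of_le_of_ne ?_ (A.avoid e _ h₁ h₂), h₃.le, ?_⟩
    · rw [← A.f_left k]
      exact hek.le h₁.le h₂.le le_rfl (A.lt k).le
    · rw [← A.f_left k]
      exact hkh.le le_rfl (A.lt k).le (hXl ▸ h₁.le) h₃.le
  have hT : T.Nonempty := by
    rcases lt_or_ge (A.X (A.right h)) (A.X (A.right e)) with hlt | hge
    · have h₁ : A.X (A.left e) < A.X (A.right h) := hXl ▸ A.lt h
      refine ⟨A.right h, ⟨h₁, hlt⟩, lt_of_le_of_ne ?_ (A.avoid e _ h₁ hlt), le_rfl,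
        (A.f_right h).ge⟩
      rw [← A.f_right h]
      exact hb.le h₁.le hlt.le (A.lt h).le le_rfl
    · have h₁ : A.X (A.left h) < A.X (A.right e) := hXl ▸ A.lt e
      have h₂ : A.f h (A.X (A.right e)) ≠ A.Y (A.right e) := by
        intro heq
        rcases hge.lt_or_eq with hlt | hXe
        · exact A.avoid h _ h₁ hlt heq
        · refine hb.ne (A.simple _ _ hl.symm (A.pos_inj _ _ hXe ?_))
          rw [← A.f_right h, ← hXe, heq]
      have h₃ : A.Y (A.right e) ≤ A.f h (A.X (A.right e)) := by
        rw [← A.f_right e]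
        exact hb.le (A.lt e).le le_rfl h₁.le hge
      refine ⟨A.left e', left_mem e' hb' (below_of_lt (z := A.X (A.right e)) ?_ hXr.ge h₁ hge ?_)⟩
      · rw [← hXr]; exact A.lt e'
      · have h₄ := A.f_right e'
        rw [hr'] at h₄
        rw [h₄]
        exact lt_of_le_of_ne h₃ h₂.symm
  obtain ⟨v, ⟨hve, hvY, hvr, hvh⟩, hvmin⟩ :=
    Set.exists_min_image T A.X (Set.toFinite _) hT
  refine ⟨v, hve, hvY, fun k hk hek hkv => ?_⟩
  have hek' : A.Below e k := ⟨_, hve, hk, hek⟩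
  have hkh : A.Below k h :=
    below_of_lt hk.1 hk.2.le (hXl ▸ hve.1) hvr (hkv.trans_le hvh)
  exact (hvmin _ (left_mem k hek' hkh)).not_gt hk.1

/-- A simple graph drawn in the plane by `x`-monotone arcs has at most three times as many edges
as vertices. -/
theorem card_le [Fintype V] [Fintype ε] (A : PlaneArcs V ε) :
    Fintype.card ε ≤ 3 * Fintype.card V := by
  classical
  let H₁ : ε → Prop := fun e => ∃ h, A.left h = A.left e ∧ A.Below e h
  let H₂ : ε → Prop := fun e => ∃ h, A.right h = A.right e ∧ A.Below e h
  have hsee : ∀ e, H₁ e → H₂ e → ∃ v, A.Sees v e := by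
    rintro e ⟨h, hl, hb⟩ ⟨e', hr, hb'⟩
    exact exists_sees hl hb hr hb'
  let F : ε → V ⊕ V ⊕ V := fun e =>
    if h₁ : H₁ e then
      if h₂ : H₂ e then Sum.inr (Sum.inr (hsee e h₁ h₂).choose) else Sum.inr (Sum.inl (A.right e))
    else Sum.inl (A.left e)
  have hF : Function.Injective F := by
    intro a b hab
    by_contra hne
    by_cases ha₁ : H₁ a <;> by_cases ha₂ : H₂ a <;> by_cases hb₁ : H₁ b <;> by_cases hb₂ : H₂ b <;>
      simp only [F, ha₁, ha₂, hb₁, hb₂, dite_true, dite_false, Sum.inr.injEq, Sum.inl.injEq,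
        reduceCtorEq] at hab
    · have h₁ := (hsee a ha₁ ha₂).choose_spec
      rw [hab] at h₁
      exact hne (h₁.unique (hsee b hb₁ hb₂).choose_spec)
    · obtain ⟨x, hxa, hxb⟩ := exists_over_of_right_eq hab
      rcases below_or_below hne hxa hxb with h | h
      · exact ha₂ ⟨b, hab.symm, h⟩
      · exact hb₂ ⟨a, hab, h⟩
    all_goals
      obtain ⟨x, hxa, hxb⟩ := exists_over_of_left_eq hab
      rcases below_or_below hne hxa hxb with h | h
      · exact ha₁ ⟨b, hab.symm, h⟩
      · exact hb₁ ⟨a, hab, h⟩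
  have := Fintype.card_le_of_injective F hF
  simp only [Fintype.card_sum] at this
  omega

end PlaneArcs

section Sampling

variable {V : Type*} [Fintype V] [DecidableEq V]

theorem card_forall_mem_eq_zero_mul (k : ℕ) [NeZero k] (T : Finset V) :
    Fintype.card {χ : V → Fin k // ∀ v ∈ T, χ v = 0} * k ^ T.card = k ^ Fintype.card V := by
  have h₁ : Fintype.card {χ : V → Fin k // ∀ v ∈ T, χ v = 0} =
      (Fintype.piFinset fun v => if v ∈ T then ({0} : Finset (Fin k)) else Finset.univ).card := by
    rw [Fintype.card_subtype]
    congr 1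
    ext χ
    simp only [Finset.mem_filter, Finset.mem_univ, true_and, Fintype.mem_piFinset]
    refine forall_congr' fun v => ?_
    by_cases hv : v ∈ T <;> simp [hv]
  have h₂ : ∀ v, (if v ∈ T then ({0} : Finset (Fin k)) else Finset.univ).card =
      if v ∈ T then 1 else k := fun v => by split_ifs <;> simp
  rw [h₁, Fintype.card_piFinset, Finset.prod_congr rfl fun v _ => h₂ v, Finset.prod_ite]
  simp only [Finset.prod_const_one, Finset.prod_const, one_mul]
  rw [← pow_add, Finset.filter_not, Finset.filter_mem_eq_inter, Finset.univ_inter,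
    Finset.card_sdiff_of_subset (Finset.subset_univ T), Finset.card_univ,
    Nat.sub_add_cancel (Finset.card_le_univ T)]

/-- Double counting of the pairs of a coloring and an object whose support gets color `0`. -/
theorem sum_card_filter_mul (k : ℕ) [NeZero k] {α : Type*} (A : Finset α) (T : α → Finset V)
    (d : ℕ) (hT : ∀ a ∈ A, (T a).card = d) :
    (∑ χ : V → Fin k, (A.filter fun a => ∀ v ∈ T a, χ v = 0).card) * k ^ d =
      A.card * k ^ Fintype.card V := by
  simp only [Finset.card_filter]
  rw [Finset.sum_comm, Finset.sum_mul, ← smul_eq_mul, ← Finset.sum_const]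
  refine Finset.sum_congr rfl fun a ha => ?_
  rw [← card_forall_mem_eq_zero_mul k (T a), hT a ha, Fintype.card_subtype, Finset.card_filter]

/-- The amplification step of the crossing lemma: if every induced subgraph has at most three
times as many edges as vertices, up to its number of crossings, then sampling vertices with
probability `1 / k` bounds the number of edges in terms of the number of crossings. -/
theorem card_mul_sq_le_of_sampling {ε γ : Type*} (E : Finset ε) (C : Finset γ)
    (eV : ε → Finset V) (cV : γ → Finset V) (he : ∀ e ∈ E, (eV e).card = 2)
    (hc : ∀ c ∈ C, (cV c).card = 4)
    (h : ∀ S : Finset V, (E.filter fun e => eV e ⊆ S).card ≤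
      3 * S.card + (C.filter fun c => cV c ⊆ S).card) (k : ℕ) [NeZero k] :
    E.card * k ^ 2 ≤ 3 * Fintype.card V * k ^ 3 + C.card := by
  have hk : 0 < k := Nat.pos_of_neZero k
  have h₁ := sum_card_filter_mul k E eV 2 he
  have h₂ := sum_card_filter_mul k C cV 4 hc
  have h₃ := sum_card_filter_mul k (Finset.univ : Finset V) (fun v => {v}) 1 (by simp)
  have h₄ : ∑ χ : V → Fin k, (E.filter fun e => ∀ v ∈ eV e, χ v = 0).card ≤
      3 * (∑ χ : V → Fin k, (Finset.univ.filter fun w => ∀ v ∈ ({w} : Finset V), χ v = 0).card) +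
        ∑ χ : V → Fin k, (C.filter fun c => ∀ v ∈ cV c, χ v = 0).card := by
    rw [Finset.mul_sum, ← Finset.sum_add_distrib]
    refine Finset.sum_le_sum fun χ _ => ?_
    simpa [Finset.subset_iff] using h (Finset.univ.filter fun v => χ v = 0)
  rw [Finset.card_univ] at h₃
  refine Nat.le_of_mul_le_mul_right (c := k ^ Fintype.card V) ?_ (by positivity)
  calc E.card * k ^ 2 * k ^ Fintype.card V
      = (∑ χ : V → Fin k, (E.filter fun e => ∀ v ∈ eV e, χ v = 0).card) * k ^ 4 := by
        rw [mul_right_comm, ← h₁]; ring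
    _ ≤ _ := Nat.mul_le_mul_right _ h₄
    _ = (3 * Fintype.card V * k ^ 3 + C.card) * k ^ Fintype.card V := by
        rw [add_mul, h₂, add_mul,
          show 3 * Fintype.card V * k ^ 3 * k ^ Fintype.card V =
            3 * (Fintype.card V * k ^ Fintype.card V) * k ^ 3 by ring, ← h₃]
        ring

end Sampling

/-- A family of graphs of continuous functions over intervals, any two of which share at most
one point. -/
structure PseudoSegments (ι : Type*) where
  g : ι → ℝ → ℝ
  D : ι → Set ℝ
  ordConnected : ∀ i, (D i).OrdConnected
  cont : ∀ i, ContinuousOn (g i) (D i)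
  inter : ∀ i j, i ≠ j → ∀ x ∈ D i ∩ D j, ∀ y ∈ D i ∩ D j, g i x = g j x → g i y = g j y → x = y

namespace PseudoSegments

variable {ι V : Type*} (Γ : PseudoSegments ι) (X Y : V → ℝ)

/-- Incidence of the point `(X v, Y v)` with the `i`-th curve. -/
def Inc (i : ι) (v : V) : Prop := X v ∈ Γ.D i ∧ Γ.g i (X v) = Y v

/-- The pieces of curves between consecutive points. -/
@[ext]
structure Edge where
  i : ι
  a : V
  b : V
  inc_a : Γ.Inc X Y i a
  inc_b : Γ.Inc X Y i b
  lt : X a < X b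
  le_of_lt : ∀ c, Γ.Inc X Y i c → X a < X c → X b ≤ X c

instance [Finite ι] [Finite V] : Finite (Γ.Edge X Y) :=
  Finite.of_injective (fun e => (e.i, e.a, e.b)) fun e e' h => by
    simp only [Prod.mk.injEq] at h
    exact Edge.ext h.1 h.2.1 h.2.2

variable {Γ X Y}

theorem Inc.eq (hpos : ∀ a b, X a = X b → Y a = Y b → a = b) {i : ι} {a b : V}
    (ha : Γ.Inc X Y i a) (hb : Γ.Inc X Y i b) (h : X a = X b) : a = b :=
  hpos a b h (by rw [← ha.2, ← hb.2, h])

namespace Edge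

theorem mem (e : Γ.Edge X Y) {x : ℝ} (h₁ : X e.a ≤ x) (h₂ : x ≤ X e.b) : x ∈ Γ.D e.i :=
  (Γ.ordConnected e.i).out e.inc_a.1 e.inc_b.1 ⟨h₁, h₂⟩

theorem eq_of_mem (hpos : ∀ a b, X a = X b → Y a = Y b → a = b) {e e' : Γ.Edge X Y}
    (hi : e.i = e'.i) {x : ℝ} (h₁ : X e.a < x) (h₂ : x < X e.b) (h₁' : X e'.a < x)
    (h₂' : x < X e'.b) : e = e' := by
  have hia : Γ.Inc X Y e.i e'.a := hi ▸ e'.inc_a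
  have hib : Γ.Inc X Y e.i e'.b := hi ▸ e'.inc_b
  have ha : X e.a = X e'.a := by
    rcases lt_trichotomy (X e.a) (X e'.a) with h | h | h
    · linarith [e.le_of_lt _ hia h]
    · exact h
    · linarith [e'.le_of_lt _ (hi ▸ e.inc_a) h]
  have hb : X e.b = X e'.b :=
    le_antisymm (e.le_of_lt _ hib (by linarith)) (e'.le_of_lt _ (hi ▸ e.inc_b) (by linarith))
  exact Edge.ext hi (e.inc_a.eq hpos hia ha) (e.inc_b.eq hpos hib hb)

/-- Two distinct edges cross if their interiors meet. -/
def Cross (e e' : Γ.Edge X Y) : Prop :=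
  e ≠ e' ∧ ∃ x, (X e.a < x ∧ x < X e.b) ∧ (X e'.a < x ∧ x < X e'.b) ∧ Γ.g e.i x = Γ.g e'.i x

theorem Cross.ne (hpos : ∀ a b, X a = X b → Y a = Y b → a = b) {e e' : Γ.Edge X Y}
    (h : Cross e e') : e.i ≠ e'.i := by
  obtain ⟨hne, x, h₁, h₂, -⟩ := h
  exact fun hi => hne (eq_of_mem hpos hi h₁.1 h₁.2 h₂.1 h₂.2)

theorem Cross.disjoint (hpos : ∀ a b, X a = X b → Y a = Y b → a = b) {e e' : Γ.Edge X Y}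
    (h : Cross e e') {v v' : V} (hv : v = e.a ∨ v = e.b) (hv' : v' = e'.a ∨ v' = e'.b) :
    v ≠ v' := by
  rintro rfl
  have hi := h.ne hpos
  obtain ⟨-, x, h₁, h₂, hx⟩ := h
  have hinc : Γ.Inc X Y e.i v := by
    rcases hv with rfl | rfl
    exacts [e.inc_a, e.inc_b]
  have hinc' : Γ.Inc X Y e'.i v := by
    rcases hv' with rfl | rfl
    exacts [e'.inc_a, e'.inc_b]
  have := Γ.inter e.i e'.i hi x ⟨e.mem h₁.1.le h₁.2.le, e'.mem h₂.1.le h₂.2.le⟩ (X v)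
    ⟨hinc.1, hinc'.1⟩ hx (hinc.2.trans hinc'.2.symm)
  rcases hv with rfl | rfl <;> linarith [h₁.1, h₁.2]

theorem Cross.eq (hpos : ∀ a b, X a = X b → Y a = Y b → a = b) {e₁ e₁' e₂ e₂' : Γ.Edge X Y}
    (h₁ : Cross e₁ e₁') (h₂ : Cross e₂ e₂') (hi : e₁.i = e₂.i) (hi' : e₁'.i = e₂'.i) :
    e₁ = e₂ ∧ e₁' = e₂' := by
  have hne := h₁.ne hpos
  obtain ⟨-, x, hx, hx', heq⟩ := h₁
  obtain ⟨-, y, hy, hy', heq'⟩ := h₂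
  have hmem := e₂.mem hy.1.le hy.2.le
  have hmem' := e₂'.mem hy'.1.le hy'.2.le
  rw [← hi] at hmem heq'
  rw [← hi'] at hmem' heq'
  have hxy := Γ.inter e₁.i e₁'.i hne x ⟨e₁.mem hx.1.le hx.2.le, e₁'.mem hx'.1.le hx'.2.le⟩ y
    ⟨hmem, hmem'⟩ heq heq'
  subst hxy
  exact ⟨eq_of_mem hpos hi hx.1 hx.2 hy.1 hy.2, eq_of_mem hpos hi' hx'.1 hx'.2 hy'.1 hy'.2⟩

end Edge

/-- A crossing-free set of edges with endpoints in `S` is a plane drawing. -/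
def planeArcs (hpos : ∀ a b, X a = X b → Y a = Y b → a = b) (S : Finset V)
    (E : Finset (Γ.Edge X Y)) (hS : ∀ e ∈ E, e.a ∈ S ∧ e.b ∈ S)
    (hE : ∀ e ∈ E, ∀ e' ∈ E, ¬ Edge.Cross e e') : PlaneArcs S E where
  X v := X v
  Y v := Y v
  left e := ⟨e.1.a, (hS e.1 e.2).1⟩
  right e := ⟨e.1.b, (hS e.1 e.2).2⟩
  f e := Γ.g e.1.i
  pos_inj a b h₁ h₂ := Subtype.ext (hpos _ _ h₁ h₂)
  lt e := e.1.lt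
  f_left e := e.1.inc_a.2
  f_right e := e.1.inc_b.2
  cont e := (Γ.cont e.1.i).mono fun _ hx => e.1.mem hx.1 hx.2
  avoid e v h₁ h₂ h₃ := (e.1.le_of_lt v ⟨e.1.mem h₁.le h₂.le, h₃⟩ h₁).not_gt h₂
  noncrossing e e' hne x h₁ h₂ h₁' h₂' h :=
    hE e.1 e.2 e'.1 e'.2 ⟨fun h => hne (Subtype.ext h), x, ⟨h₁, h₂⟩, ⟨h₁', h₂'⟩, h⟩
  simple := by
    rintro ⟨e, he⟩ ⟨e', he'⟩ ha hb
    simp only [Subtype.mk.injEq] at ha hb ⊢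
    have hi : e.i = e'.i := by
      by_contra hi
      have ha' := e'.inc_a
      have hb' := e'.inc_b
      rw [← ha] at ha'
      rw [← hb] at hb'
      exact e.lt.ne (Γ.inter _ _ hi _ ⟨e.inc_a.1, ha'.1⟩ _ ⟨e.inc_b.1, hb'.1⟩
        (e.inc_a.2.trans ha'.2.symm) (e.inc_b.2.trans hb'.2.symm))
    exact Edge.ext hi ha hb

theorem card_edge_mul_sq_le [Fintype ι] [Fintype V]
    (hpos : ∀ a b, X a = X b → Y a = Y b → a = b) (k : ℕ) [NeZero k] :
    Nat.card (Γ.Edge X Y) * k ^ 2 ≤ 3 * Fintype.card V * k ^ 3 + Fintype.card ι ^ 2 := by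
  classical
  have := Fintype.ofFinite (Γ.Edge X Y)
  let C : Finset (Γ.Edge X Y × Γ.Edge X Y) := Finset.univ.filter fun c => Edge.Cross c.1 c.2
  have hC : C.card ≤ Fintype.card ι ^ 2 := by
    rw [sq, ← Fintype.card_prod, ← Finset.card_univ]
    refine Finset.card_le_card_of_injOn (fun c => (c.1.i, c.2.i)) (fun _ _ => Finset.mem_univ _) ?_
    intro c hc c' hc' h
    simp only [Prod.mk.injEq] at h
    have := Edge.Cross.eq hpos (Finset.mem_filter.1 hc).2 (Finset.mem_filter.1 hc').2 h.1 h.2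
    exact Prod.ext this.1 this.2
  rw [Nat.card_eq_fintype_card, ← Finset.card_univ]
  refine (card_mul_sq_le_of_sampling Finset.univ C (fun e => {e.a, e.b})
    (fun c => {c.1.a, c.1.b} ∪ {c.2.a, c.2.b}) ?_ ?_ ?_ k).trans (by gcongr)
  · exact fun e _ => Finset.card_pair fun h => e.lt.ne (by rw [h])
  · intro c hc
    have hcr := (Finset.mem_filter.1 hc).2
    rw [Finset.card_union_of_disjoint, Finset.card_pair fun h => c.1.lt.ne (by rw [h]),
      Finset.card_pair fun h => c.2.lt.ne (by rw [h])]
    rw [Finset.disjoint_left]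
    intro v hv hv'
    simp only [Finset.mem_insert, Finset.mem_singleton] at hv hv'
    exact hcr.disjoint hpos hv hv' rfl
  · intro S
    set ES : Finset (Γ.Edge X Y) := Finset.univ.filter fun e => ({e.a, e.b} : Finset V) ⊆ S
    set CS := C.filter fun c => ({c.1.a, c.1.b} ∪ {c.2.a, c.2.b} : Finset V) ⊆ S
    have hES : ∀ e ∈ ES, e.a ∈ S ∧ e.b ∈ S := by
      intro e he
      simpa [ES, Finset.insert_subset_iff] using he
    have h₁ : (ES \ CS.image Prod.fst).card ≤ 3 * S.card := by
      have := (planeArcs (Γ := Γ) hpos S (ES \ CS.image Prod.fst)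
        (fun e he => hES e (Finset.mem_sdiff.1 he).1) ?_).card_le
      · rwa [Fintype.card_coe, Fintype.card_coe] at this
      · intro e he e' he' hcr
        refine (Finset.mem_sdiff.1 he).2 (Finset.mem_image.2 ⟨(e, e'), ?_, rfl⟩)
        simp only [CS, C, Finset.mem_filter, Finset.mem_univ, true_and]
        refine ⟨hcr, Finset.union_subset ?_ ?_⟩
        · exact (Finset.mem_filter.1 (Finset.mem_sdiff.1 he).1).2
        · exact (Finset.mem_filter.1 (Finset.mem_sdiff.1 he').1).2
    have h₂ : ES.card ≤ (CS.image Prod.fst).card + (ES \ CS.image Prod.fst).card := by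
      rw [add_comm]
      exact Finset.card_le_card_sdiff_add_card
    have h₃ : (CS.image Prod.fst).card ≤ CS.card := Finset.card_image_le
    omega

theorem card_inc_le [Finite ι] [Finite V] (hpos : ∀ a b, X a = X b → Y a = Y b → a = b) :
    Nat.card {p : ι × V // Γ.Inc X Y p.1 p.2} ≤ Nat.card ι + Nat.card (Γ.Edge X Y) := by
  classical
  let P : {p : ι × V // Γ.Inc X Y p.1 p.2} → Prop := fun p =>
    ∃ e : Γ.Edge X Y, e.i = p.1.1 ∧ e.a = p.1.2
  have hlast : ∀ p, ¬ P p → ∀ c, Γ.Inc X Y p.1.1 c → X c ≤ X p.1.2 := by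
    intro p hp c hc
    by_contra! hlt
    obtain ⟨b, ⟨hb, hpb⟩, hmin⟩ := Set.exists_min_image
      {b | Γ.Inc X Y p.1.1 b ∧ X p.1.2 < X b} X (Set.toFinite _) ⟨c, hc, hlt⟩
    exact hp ⟨⟨p.1.1, p.1.2, b, p.2, hb, hpb, fun c hc h => hmin c ⟨hc, h⟩⟩, rfl, rfl⟩
  let F : {p : ι × V // Γ.Inc X Y p.1 p.2} → ι ⊕ Γ.Edge X Y := fun p =>
    if h : P p then Sum.inr h.choose else Sum.inl p.1.1
  have hF : Function.Injective F := by
    intro p q hpq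
    by_cases hp : P p <;> by_cases hq : P q <;>
      simp only [F, hp, hq, dite_true, dite_false, Sum.inr.injEq, Sum.inl.injEq,
        reduceCtorEq] at hpq
    · refine Subtype.ext (Prod.ext ?_ ?_)
      · rw [← hp.choose_spec.1, hpq, hq.choose_spec.1]
      · rw [← hp.choose_spec.2, hpq, hq.choose_spec.2]
    · have hq' : Γ.Inc X Y p.1.1 q.1.2 := hpq ▸ q.2
      have hp' : Γ.Inc X Y q.1.1 p.1.2 := hpq ▸ p.2
      exact Subtype.ext (Prod.ext hpq (p.2.eq hpos hq'
        (le_antisymm (hlast q hq _ hp') (hlast p hp _ hq'))))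
  simpa [Nat.card_sum] using Nat.card_le_card_of_injective F hF

/-- The Szemerédi–Trotter bound for at most `n` points and at most `n` pseudo-segments. -/
theorem card_inc_le_rpow [Fintype ι] [Fintype V]
    (hpos : ∀ a b, X a = X b → Y a = Y b → a = b) {n : ℕ} (hι : Fintype.card ι ≤ n)
    (hV : Fintype.card V ≤ n) :
    (Nat.card {p : ι × V // Γ.Inc X Y p.1 p.2} : ℝ) ≤ 8 * (n : ℝ) ^ ((4 : ℝ) / 3) := by
  have h₁ := card_inc_le (Γ := Γ) hpos
  have h₂ : ∀ (k : ℕ) [NeZero k], Nat.card (Γ.Edge X Y) * k ^ 2 ≤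
      3 * Fintype.card V * k ^ 3 + Fintype.card ι ^ 2 :=
    fun k _ => card_edge_mul_sq_le hpos k
  rw [Nat.card_eq_fintype_card (α := ι)] at h₁
  set N := Nat.card {p : ι × V // Γ.Inc X Y p.1 p.2}
  set e := Nat.card (Γ.Edge X Y)
  rcases Nat.eq_zero_or_pos n with rfl | hn
  · have : e = 0 := by
      have h := h₂ 1
      have h3 : Fintype.card ι = 0 := by omega
      have h4 : Fintype.card V = 0 := by omega
      simpa [h3, h4] using h
    have hN : N = 0 := by omega
    rw [hN, Nat.cast_zero]
    positivity
  have hn1 : (1 : ℝ) ≤ n := by exact_mod_cast hn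
  obtain ⟨r, hr, hrn⟩ : ∃ r : ℝ, 0 < r ∧ r ^ 3 = n :=
    ⟨(n : ℝ) ^ ((1 : ℝ) / 3), by positivity, by
      rw [← Real.rpow_natCast, ← Real.rpow_mul (by positivity)]; norm_num⟩
  have hr1 : 1 ≤ r := by
    by_contra! h
    nlinarith [pow_lt_one₀ hr.le h (by norm_num : 3 ≠ 0)]
  have hpow : (n : ℝ) ^ ((4 : ℝ) / 3) = r ^ 4 := by
    rw [← hrn, ← Real.rpow_natCast, ← Real.rpow_natCast, ← Real.rpow_mul hr.le]
    norm_num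
  rw [hpow]
  have hN : (N : ℝ) ≤ n + e := by exact_mod_cast h₁.trans (by omega)
  have hnr : (n : ℝ) ≤ r ^ 4 := by
    rw [← hrn]
    exact pow_le_pow_right₀ hr1 (by norm_num)
  obtain ⟨k, hk₁, hk₂⟩ : ∃ k : ℕ, r ≤ k ∧ (k : ℝ) ≤ r + 1 :=
    ⟨⌈r⌉₊, Nat.le_ceil r, (Nat.ceil_lt_add_one hr.le).le⟩
  have hk0 : k ≠ 0 := by
    rintro rfl
    simp at hk₁
    linarith
  have : NeZero k := ⟨hk0⟩
  have h₃ : (e : ℝ) * k ^ 2 ≤ 3 * n * k ^ 3 + n ^ 2 := by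
    have : e * k ^ 2 ≤ 3 * n * k ^ 3 + n ^ 2 := (h₂ k).trans (by gcongr)
    exact_mod_cast this
  have hk2 : (0 : ℝ) < (k : ℝ) ^ 2 := by positivity
  have h₄ : (e : ℝ) ≤ 7 * r ^ 4 := by
    refine le_of_mul_le_mul_right (h₃.trans ?_) hk2
    have h₅ : (n : ℝ) ^ 2 ≤ r ^ 4 * (k : ℝ) ^ 2 := by
      rw [← hrn]
      calc (r ^ 3) ^ 2 = r ^ 4 * r ^ 2 := by ring
        _ ≤ _ := by gcongr
    have h₆ : 3 * (n : ℝ) * k ^ 3 ≤ 6 * r ^ 4 * k ^ 2 := by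
      rw [← hrn]
      calc 3 * r ^ 3 * (k : ℝ) ^ 3 = 3 * r ^ 3 * k ^ 2 * k := by ring
        _ ≤ 3 * r ^ 3 * k ^ 2 * (2 * r) := by gcongr; linarith
        _ = _ := by ring
    linarith
  linarith

end PseudoSegments

theorem Pt2.ext_coord {p q : Pt2} (h₀ : p 0 = q 0) (h₁ : p 1 = q 1) : p = q := by
  ext i
  fin_cases i
  exacts [h₀, h₁]

theorem Pt2.norm_sub_sq (p q : Pt2) : ‖p - q‖ ^ 2 = (p 0 - q 0) ^ 2 + (p 1 - q 1) ^ 2 := by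
  simp [EuclideanSpace.norm_sq_eq, Fin.sum_univ_two]

theorem Pt2.inner_eq (p q : Pt2) : ⟪p, q⟫_ℝ = p 0 * q 0 + p 1 * q 1 := by
  simp [PiLp.inner_apply, Fin.sum_univ_two, mul_comm]

open Classical in
/-- Pairs of points of `E` related by `R`. -/
def relPairs (R : Pt2 → Pt2 → Prop) (E : Finset Pt2) : Finset (Pt2 × Pt2) :=
  (E ×ˢ E).filter fun p => R p.1 p.2

open Classical in
/-- Triples of points of `E` with distinct ends, consecutive points being related by `R`
and `R'`. -/
def relTriples (R R' : Pt2 → Pt2 → Prop) (E : Finset Pt2) : Finset (Pt2 × Pt2 × Pt2) :=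
  (E ×ˢ E ×ˢ E).filter fun p => R p.1 p.2.1 ∧ R' p.2.1 p.2.2 ∧ p.1 ≠ p.2.2

theorem mem_relPairs {R : Pt2 → Pt2 → Prop} {E : Finset Pt2} {p : Pt2 × Pt2} :
    p ∈ relPairs R E ↔ (p.1 ∈ E ∧ p.2 ∈ E) ∧ R p.1 p.2 := by
  simp [relPairs]

theorem mem_relTriples {R R' : Pt2 → Pt2 → Prop} {E : Finset Pt2} {p : Pt2 × Pt2 × Pt2} :
    p ∈ relTriples R R' E ↔
      (p.1 ∈ E ∧ p.2.1 ∈ E ∧ p.2.2 ∈ E) ∧ R p.1 p.2.1 ∧ R' p.2.1 p.2.2 ∧ p.1 ≠ p.2.2 := by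
  simp [relTriples]

/-- The Szemerédi–Trotter bound for a set of pairs of points of `E`, the first of which
parametrizes a family of pseudo-segments and the second of which is incident to it. -/
theorem card_le_of_pseudoSegments {E E' : Finset Pt2} (hE : E'.card ≤ E.card)
    (Γ : PseudoSegments E') (U : Finset (Pt2 × Pt2))
    (hU : ∀ p ∈ U, ∃ h : p.1 ∈ E', p.2 ∈ E ∧ p.2 0 ∈ Γ.D ⟨p.1, h⟩ ∧
      Γ.g ⟨p.1, h⟩ (p.2 0) = p.2 1) :
    (U.card : ℝ) ≤ 8 * (E.card : ℝ) ^ ((4 : ℝ) / 3) := by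
  let X : E → ℝ := fun v => v.1 0
  let Y : E → ℝ := fun v => v.1 1
  have hmain := PseudoSegments.card_inc_le_rpow (Γ := Γ) (X := X) (Y := Y) (n := E.card)
    (fun a b h₀ h₁ => Subtype.ext (Pt2.ext_coord h₀ h₁)) (by simpa using hE) (by simp)
  refine le_trans ?_ hmain
  rw [← Fintype.card_coe, ← Nat.card_eq_fintype_card]
  refine Nat.cast_le.2 (Nat.card_le_card_of_injective
    (fun p : U => ⟨(⟨p.1.1, (hU p.1 p.2).choose⟩, ⟨p.1.2, (hU p.1 p.2).choose_spec.1⟩),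
      (hU p.1 p.2).choose_spec.2⟩) fun p q h => ?_)
  exact Subtype.ext (Prod.ext (congrArg (fun z => (z.1.1 : Pt2)) h)
    (congrArg (fun z => (z.1.2 : Pt2)) h))

/-- The number of pairs at a given positive distance. -/
theorem card_relPairs_dist_le {r : ℝ} (hr : 0 < r) (E : Finset Pt2) :
    ((relPairs (fun p q => ‖p - q‖ = r) E).card : ℝ) ≤ 16 * (E.card : ℝ) ^ ((4 : ℝ) / 3) := by
  classical
  have hsq : ∀ {x c : ℝ}, x ∈ Set.Icc (c - r) (c + r) → 0 ≤ r ^ 2 - (x - c) ^ 2 := by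
    intro x c hx
    nlinarith [hx.1, hx.2]
  let Γ : PseudoSegments E :=
    { g := fun p x => p.1 1 + √(r ^ 2 - (x - p.1 0) ^ 2)
      D := fun p => Set.Icc (p.1 0 - r) (p.1 0 + r)
      ordConnected := fun p => Set.ordConnected_Icc
      cont := fun p => by fun_prop
      inter := by
        rintro ⟨p, _⟩ ⟨q, _⟩ hpq x ⟨hxp, hxq⟩ y ⟨hyp, hyq⟩ hx hy
        simp only at hxp hxq hyp hyq hx hy
        have A₁ := Real.sq_sqrt (hsq hxp)
        have B₁ := Real.sq_sqrt (hsq hxq)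
        have A₂ := Real.sq_sqrt (hsq hyp)
        have B₂ := Real.sq_sqrt (hsq hyq)
        have a₁ := Real.sqrt_nonneg (r ^ 2 - (x - p 0) ^ 2)
        have b₁ := Real.sqrt_nonneg (r ^ 2 - (x - q 0) ^ 2)
        have a₂ := Real.sqrt_nonneg (r ^ 2 - (y - p 0) ^ 2)
        have b₂ := Real.sqrt_nonneg (r ^ 2 - (y - q 0) ^ 2)
        set a := √(r ^ 2 - (x - p 0) ^ 2)
        set b := √(r ^ 2 - (x - q 0) ^ 2)
        set a' := √(r ^ 2 - (y - p 0) ^ 2)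
        set b' := √(r ^ 2 - (y - q 0) ^ 2)
        by_contra hxy
        obtain ⟨c, hc⟩ : ∃ c, c = q 1 - p 1 := ⟨_, rfl⟩
        obtain ⟨d, hd⟩ : ∃ d, d = q 0 - p 0 := ⟨_, rfl⟩
        obtain ⟨s, hs⟩ : ∃ s, s = x - p 0 := ⟨_, rfl⟩
        obtain ⟨t, ht⟩ : ∃ t, t = y - p 0 := ⟨_, rfl⟩
        have hst : s - t ≠ 0 := by
          intro h
          apply hxy
          linarith
        have hb : b = a - c := by linarith
        have hb' : b' = a' - c := by linarith
        rw [show x - p 0 = s from hs.symm] at A₁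
        rw [show y - p 0 = t from ht.symm] at A₂
        rw [show x - q 0 = s - d by linarith, hb] at B₁
        rw [show y - q 0 = t - d by linarith, hb'] at B₂
        rw [hb] at b₁
        rw [hb'] at b₂
        have e₁ : 2 * s * d + 2 * a * c = d ^ 2 + c ^ 2 := by linarith
        have e₂ : 2 * t * d + 2 * a' * c = d ^ 2 + c ^ 2 := by linarith
        have e₃ : (s - t) * d = (a' - a) * c := by linarith
        have e₄ : (s - t) * (s + t) = (a' - a) * (a' + a) := by linarith
        have hcd : c = 0 → d ≠ 0 := by
          intro hc0 hd0
          exact hpq (Subtype.ext (Pt2.ext_coord (by linarith) (by linarith)))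
        have hc0 : c ≠ 0 := by
          intro hc0
          have := hcd hc0
          rw [hc0, mul_zero] at e₃
          exact (mul_ne_zero hst this) e₃
        have e₅ : (s + t) * c = (a' + a) * d := by
          refine mul_left_cancel₀ hst ?_
          linear_combination c * e₄ - (a' + a) * e₃
        have hdc : d ^ 2 + c ^ 2 ≠ 0 := by positivity
        have e₆ : a' + a = c := by
          refine mul_right_cancel₀ hdc ?_
          linear_combination c / 2 * e₁ + c / 2 * e₂ - d * e₅
        have : c = 0 := by linarith
        exact hc0 this }
  set P := relPairs (fun p q => ‖p - q‖ = r) E with hP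
  let U := P.filter fun p => p.1 1 ≤ p.2 1
  have hU : (U.card : ℝ) ≤ 8 * (E.card : ℝ) ^ ((4 : ℝ) / 3) := by
    refine card_le_of_pseudoSegments le_rfl Γ U fun p hp => ?_
    obtain ⟨hp, hle⟩ := Finset.mem_filter.1 hp
    obtain ⟨⟨h₁, h₂⟩, hd⟩ := mem_relPairs.1 hp
    have hn := Pt2.norm_sub_sq p.1 p.2
    rw [hd] at hn
    have habs : |p.2 0 - p.1 0| ≤ r :=
      abs_le_of_sq_le_sq (by nlinarith [sq_nonneg (p.1 1 - p.2 1)]) hr.le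
    rw [abs_le] at habs
    refine ⟨h₁, h₂, ⟨by linarith, by linarith⟩, ?_⟩
    change p.1 1 + √(r ^ 2 - (p.2 0 - p.1 0) ^ 2) = p.2 1
    rw [show r ^ 2 - (p.2 0 - p.1 0) ^ 2 = (p.2 1 - p.1 1) ^ 2 by rw [hn]; ring,
      Real.sqrt_sq (by linarith)]
    ring
  have hsub : P ⊆ U ∪ U.image Prod.swap := by
    intro p hp
    rcases le_total (p.1 1) (p.2 1) with h | h
    · exact Finset.mem_union_left _ (Finset.mem_filter.2 ⟨hp, h⟩)
    · refine Finset.mem_union_right _ (Finset.mem_image.2 ⟨p.swap, ?_, p.swap_swap⟩)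
      obtain ⟨⟨h₁, h₂⟩, hd⟩ := mem_relPairs.1 hp
      exact Finset.mem_filter.2 ⟨mem_relPairs.2 ⟨⟨h₂, h₁⟩, by rw [← hd]; exact norm_sub_rev _ _⟩, h⟩
  have hcard : P.card ≤ U.card + U.card :=
    (Finset.card_le_card hsub).trans ((Finset.card_union_le _ _).trans
      (Nat.add_le_add_left Finset.card_image_le _))
  have : (P.card : ℝ) ≤ U.card + U.card := by exact_mod_cast hcard
  linarith

/-- The number of pairs with a given nonzero dot product. -/
theorem card_relPairs_inner_le {r : ℝ} (hr : r ≠ 0) (E : Finset Pt2) :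
    ((relPairs (fun p q => ⟪p, q⟫_ℝ = r) E).card : ℝ) ≤ 16 * (E.card : ℝ) ^ ((4 : ℝ) / 3) := by
  classical
  let Γ : PseudoSegments (E.filter fun p => p 1 ≠ 0) :=
    { g := fun p x => (r - p.1 0 * x) / p.1 1
      D := fun _ => Set.univ
      ordConnected := fun _ => Set.ordConnected_univ
      cont := fun p => by fun_prop
      inter := by
        rintro ⟨p, hp⟩ ⟨q, hq⟩ hpq x - y - hx hy
        have hp1 := (Finset.mem_filter.1 hp).2
        have hq1 := (Finset.mem_filter.1 hq).2
        simp only at hx hy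
        rw [div_eq_div_iff hp1 hq1] at hx hy
        by_contra hxy
        have h₁ : p 0 * q 1 = q 0 * p 1 := by
          refine mul_left_cancel₀ (sub_ne_zero.2 hxy) ?_
          linear_combination hy - hx
        have h₂ : p 1 = q 1 := by
          refine mul_left_cancel₀ hr ?_
          linear_combination - hx - x * h₁
        have h₃ : p 0 = q 0 := by
          rw [h₂] at h₁
          exact mul_right_cancel₀ hq1 h₁
        exact hpq (Subtype.ext (Pt2.ext_coord h₃ h₂)) }
  set P := relPairs (fun p q => ⟪p, q⟫_ℝ = r) E
  have hU : ((P.filter fun p => p.1 1 ≠ 0).card : ℝ) ≤ 8 * (E.card : ℝ) ^ ((4 : ℝ) / 3) := by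
    refine card_le_of_pseudoSegments (Finset.card_filter_le _ _) Γ _ fun p hp => ?_
    obtain ⟨hp, hp1⟩ := Finset.mem_filter.1 hp
    obtain ⟨⟨h₁, h₂⟩, hd⟩ := mem_relPairs.1 hp
    rw [Pt2.inner_eq] at hd
    refine ⟨Finset.mem_filter.2 ⟨h₁, hp1⟩, h₂, Set.mem_univ _, ?_⟩
    change (r - p.1 0 * p.2 0) / p.1 1 = p.2 1
    rw [div_eq_iff hp1]
    linarith
  have hW : (P.filter fun p => ¬ p.1 1 ≠ 0).card ≤ E.card := by
    refine Finset.card_le_card_of_injOn Prod.snd ?_ ?_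
    · intro p hp
      exact (mem_relPairs.1 (Finset.mem_filter.1 hp).1).1.2
    · intro p hp q hq hpq
      obtain ⟨hp, hp1⟩ := Finset.mem_filter.1 hp
      obtain ⟨hq, hq1⟩ := Finset.mem_filter.1 hq
      have hdp := (mem_relPairs.1 hp).2
      have hdq := (mem_relPairs.1 hq).2
      rw [Pt2.inner_eq, not_not.1 hp1, zero_mul, add_zero] at hdp
      rw [Pt2.inner_eq, not_not.1 hq1, zero_mul, add_zero, ← hpq] at hdq
      have h0 : p.2 0 ≠ 0 := fun h => hr (by rw [← hdp, h, mul_zero])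
      refine Prod.ext (Pt2.ext_coord (mul_right_cancel₀ h0 (hdp.trans hdq.symm)) ?_) hpq
      rw [not_not.1 hp1, not_not.1 hq1]
  have hE : (E.card : ℝ) ≤ (E.card : ℝ) ^ ((4 : ℝ) / 3) := by
    rcases Nat.eq_zero_or_pos E.card with h | h
    · rw [h, Nat.cast_zero]
      positivity
    · exact Real.self_le_rpow_of_one_le (by exact_mod_cast h) (by norm_num)
  have hP := Finset.card_filter_add_card_filter_not (s := P) fun p => p.1 1 ≠ 0
  have hP' : (P.card : ℝ) ≤ (P.filter fun p => p.1 1 ≠ 0).card + E.card := by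
    rw [← Nat.cast_add, Nat.cast_le]
    omega
  have : (0 : ℝ) ≤ (E.card : ℝ) ^ ((4 : ℝ) / 3) := by positivity
  linarith

theorem card_relTriples_dist_le (r r' : ℝ) (E : Finset Pt2) :
    (relTriples (fun p q => ‖p - q‖ = r) (fun p q => ‖p - q‖ = r') E).card ≤
      2 * E.card ^ 2 := by
  classical
  set T := relTriples (fun p q => ‖p - q‖ = r) (fun p q => ‖p - q‖ = r') E
  refine (Finset.card_le_mul_card_image (f := fun p => (p.1, p.2.2)) T 2 ?_).trans ?_
  · intro c _
    by_contra! h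
    obtain ⟨p₁, h₁, p₂, h₂, p₃, h₃, h₁₂, h₁₃, h₂₃⟩ := Finset.two_lt_card.1 h
    have hfib : ∀ p ∈ T.filter (fun p => (p.1, p.2.2) = c),
        p = (c.1, p.2.1, c.2) ∧ dist p.2.1 c.1 = r ∧ dist p.2.1 c.2 = r' ∧ c.1 ≠ c.2 := by
      rintro p hp
      obtain ⟨hpT, rfl⟩ := Finset.mem_filter.1 hp
      obtain ⟨-, hd, hd', hne⟩ := mem_relTriples.1 hpT
      exact ⟨rfl, by rw [dist_comm, dist_eq_norm, hd], by rw [dist_eq_norm, hd'], hne⟩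
    obtain ⟨e₁, d₁, d₁', hne⟩ := hfib p₁ h₁
    obtain ⟨e₂, d₂, d₂', -⟩ := hfib p₂ h₂
    obtain ⟨e₃, d₃, d₃', -⟩ := hfib p₃ h₃
    have hy : p₁.2.1 ≠ p₂.2.1 := fun h => h₁₂ (by rw [e₁, e₂, h])
    rcases EuclideanGeometry.eq_of_dist_eq_of_dist_eq_of_finrank_eq_two (by simp) hne hy
      d₁ d₂ d₃ d₁' d₂' d₃' with h | h
    · exact h₁₃ (by rw [e₁, e₃, h])
    · exact h₂₃ (by rw [e₂, e₃, h])
  · rw [sq, ← Finset.card_product]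
    refine Nat.mul_le_mul_left _ (Finset.card_le_card (Finset.image_subset_iff.2 fun p hp => ?_))
    obtain ⟨⟨h₁, -, h₃⟩, -⟩ := mem_relTriples.1 hp
    exact Finset.mk_mem_product h₁ h₃

theorem card_relTriples_inner_le {r : ℝ} (hr : r ≠ 0) (r' : ℝ) (E : Finset Pt2) :
    (relTriples (fun p q => ⟪p, q⟫_ℝ = r) (fun p q => ⟪p, q⟫_ℝ = r') E).card ≤
      2 * E.card ^ 2 := by
  classical
  set T := relTriples (fun p q => ⟪p, q⟫_ℝ = r) (fun p q => ⟪p, q⟫_ℝ = r') E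
  have hT : ∀ p ∈ T, (p.1 ∈ E ∧ p.2.1 ∈ E ∧ p.2.2 ∈ E) ∧
      p.1 0 * p.2.1 0 + p.1 1 * p.2.1 1 = r ∧ p.2.1 0 * p.2.2 0 + p.2.1 1 * p.2.2 1 = r' := by
    intro p hp
    obtain ⟨hE, h, h', -⟩ := mem_relTriples.1 hp
    rw [Pt2.inner_eq] at h h'
    exact ⟨hE, h, h'⟩
  let dep : Pt2 × Pt2 × Pt2 → Prop := fun p => p.1 0 * p.2.2 1 = p.1 1 * p.2.2 0
  have h₁ : (T.filter dep).card ≤ E.card ^ 2 := by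
    rw [sq, ← Finset.card_product]
    refine Finset.card_le_card_of_injOn (fun p => (p.1, p.2.1)) ?_ ?_
    · intro p hp
      have h := (hT p (Finset.mem_filter.1 hp).1).1
      exact Finset.mk_mem_product h.1 h.2.1
    · rintro ⟨x, y, z⟩ hp ⟨x', y', z'⟩ hq hpq
      simp only [Prod.mk.injEq] at hpq
      obtain ⟨rfl, rfl⟩ := hpq
      obtain ⟨hp, hd⟩ := Finset.mem_filter.1 hp
      obtain ⟨hq, hd'⟩ := Finset.mem_filter.1 hq
      obtain ⟨-, hr₁, hr₂⟩ := hT _ hp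
      obtain ⟨-, -, hr₃⟩ := hT _ hq
      simp only [dep] at hd hd' hr₁ hr₂ hr₃
      have h₀ : z 0 = z' 0 := by
        refine mul_left_cancel₀ hr ?_
        linear_combination (z' 0 - z 0) * hr₁ + x 0 * (hr₂ - hr₃) - y 1 * (hd - hd')
      have h₁ : z 1 = z' 1 := by
        refine mul_left_cancel₀ hr ?_
        linear_combination (z' 1 - z 1) * hr₁ + x 1 * (hr₂ - hr₃) + y 0 * (hd - hd')
      rw [Pt2.ext_coord h₀ h₁]
  have h₂ : (T.filter fun p => ¬ dep p).card ≤ E.card ^ 2 := by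
    rw [sq, ← Finset.card_product]
    refine Finset.card_le_card_of_injOn (fun p => (p.1, p.2.2)) ?_ ?_
    · intro p hp
      have h := (hT p (Finset.mem_filter.1 hp).1).1
      exact Finset.mk_mem_product h.1 h.2.2
    · rintro ⟨x, y, z⟩ hp ⟨x', y', z'⟩ hq hpq
      simp only [Prod.mk.injEq] at hpq
      obtain ⟨rfl, rfl⟩ := hpq
      obtain ⟨hp, hd⟩ := Finset.mem_filter.1 hp
      obtain ⟨hq, -⟩ := Finset.mem_filter.1 hq
      obtain ⟨-, hr₁, hr₂⟩ := hT _ hp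
      obtain ⟨-, hr₃, hr₄⟩ := hT _ hq
      simp only [dep] at hd hr₁ hr₂ hr₃ hr₄
      have h₀ : y 0 = y' 0 := by
        refine mul_left_cancel₀ (sub_ne_zero.2 hd) ?_
        linear_combination z 1 * (hr₁ - hr₃) - x 1 * (hr₂ - hr₄)
      have h₁ : y 1 = y' 1 := by
        refine mul_left_cancel₀ (sub_ne_zero.2 hd) ?_
        linear_combination x 0 * (hr₂ - hr₄) - z 0 * (hr₁ - hr₃)
      rw [Pt2.ext_coord h₀ h₁]
  have := Finset.card_filter_add_card_filter_not (s := T) dep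
  omega

/-- Bounds for pairs and triples multiply up along a cover of the graph by paths. -/
theorem ncard_configs_le_of_cover {V : Type*} (G : SimpleGraph V) (w : V → V → ℝ) {s t : ℕ}
    (hcov : IsSTCovered G s t) (R : ℝ → Pt2 → Pt2 → Prop)
    (hpair : ∀ u v, G.Adj u v → ∀ E : Finset Pt2,
      ((relPairs (R (w u v)) E).card : ℝ) ≤ 16 * (E.card : ℝ) ^ ((4 : ℝ) / 3))
    (htriple : ∀ u v x, G.Adj u v → G.Adj v x → ∀ E : Finset Pt2,
      (relTriples (R (w u v)) (R (w v x)) E).card ≤ 2 * E.card ^ 2) :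
    ∃ C : ℝ, 0 < C ∧ ∀ (n : ℕ) (E : Finset Pt2), E.card = n →
      (({φ : V → Pt2 | (∀ v, φ v ∈ E) ∧ Function.Injective φ ∧
        ∀ u v, G.Adj u v → R (w u v) (φ u) (φ v)}.ncard : ℕ) : ℝ) ≤
          C * (n : ℝ) ^ ((4 : ℝ) / 3 * s + 2 * t) := by
  obtain ⟨F, hF, hs, ht⟩ := hcov
  refine ⟨16 ^ s * 2 ^ t, by positivity, ?_⟩
  rintro n E rfl
  set Φ := {φ : V → Pt2 | (∀ v, φ v ∈ E) ∧ Function.Injective φ ∧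
    ∀ u v, G.Adj u v → R (w u v) (φ u) (φ v)}
  let a : Fin s → Fin 2 → V := fun i k => F (Sum.inl (i, k))
  let b : Fin t → Fin 3 → V := fun j k => F (Sum.inr (j, k))
  let H : Φ → (∀ i, relPairs (R (w (a i 0) (a i 1))) E) ×
      (∀ j, relTriples (R (w (b j 0) (b j 1))) (R (w (b j 1) (b j 2))) E) := fun φ =>
    (fun i => ⟨(φ.1 (a i 0), φ.1 (a i 1)),
      mem_relPairs.2 ⟨⟨φ.2.1 _, φ.2.1 _⟩, φ.2.2.2 _ _ (hs i)⟩⟩,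
    fun j => ⟨(φ.1 (b j 0), φ.1 (b j 1), φ.1 (b j 2)),
      mem_relTriples.2 ⟨⟨φ.2.1 _, φ.2.1 _, φ.2.1 _⟩, φ.2.2.2 _ _ (ht j).1, φ.2.2.2 _ _ (ht j).2,
        fun h => by simpa using hF.1 (φ.2.2.1 h)⟩⟩)
  have hH : Function.Injective H := by
    intro φ ψ h
    refine Subtype.ext (funext fun v => ?_)
    obtain ⟨h₁, h₂⟩ := Prod.ext_iff.1 h
    obtain ⟨⟨i, k⟩ | ⟨j, k⟩, rfl⟩ := hF.2 v
    · have := congrArg Subtype.val (congrFun h₁ i)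
      simp only [H, Prod.mk.injEq] at this
      fin_cases k
      exacts [this.1, this.2]
    · have := congrArg Subtype.val (congrFun h₂ j)
      simp only [H, Prod.mk.injEq] at this
      fin_cases k
      exacts [this.1, this.2.1, this.2.2]
  have hcard := Nat.card_le_card_of_injective H hH
  rw [Nat.card_prod, Nat.card_pi, Nat.card_pi, Nat.card_coe_set_eq] at hcard
  simp only [Nat.card_eq_fintype_card, Fintype.card_coe] at hcard
  calc (Φ.ncard : ℝ) ≤ (∏ i, ((relPairs (R (w (a i 0) (a i 1))) E).card : ℝ)) *
        ∏ j, ((relTriples (R (w (b j 0) (b j 1))) (R (w (b j 1) (b j 2))) E).card : ℝ) := by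
        exact_mod_cast hcard
    _ ≤ (∏ _i : Fin s, 16 * (E.card : ℝ) ^ ((4 : ℝ) / 3)) *
        ∏ _j : Fin t, 2 * (E.card : ℝ) ^ (2 : ℝ) := by
        gcongr with i _ j _
        · exact hpair _ _ (hs i) E
        · rw [Real.rpow_two]
          exact_mod_cast htriple _ _ _ (ht j).1 (ht j).2 E
    _ = 16 ^ s * 2 ^ t * (E.card : ℝ) ^ ((4 : ℝ) / 3 * s + 2 * t) := by
        rw [Real.rpow_add_of_nonneg (by positivity) (by positivity) (by positivity),
          Real.rpow_mul (by positivity), Real.rpow_mul (by positivity)]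
        simp only [Finset.prod_const, Finset.card_univ, Fintype.card_fin, mul_pow,
          Real.rpow_natCast]
        ring

/-- **graph covering theorem, in the plane.**  Let `G` be a finite
edge-weighted graph that can be `(s, t)`-covered.  If all edge weights are positive then
there is a constant `C` such that every set of `n` points in the plane has at most
`C · n^((4/3)s + 2t)` distance `G`-configurations; if all edge weights are nonzero then
the same bound holds for dot product `G`-configurations. -/
theorem graph_cover_bounds {V : Type*} [Fintype V] (G : SimpleGraph V) (w : V → V → ℝ)
    (hsym : ∀ u v, w u v = w v u) (s t : ℕ) (hcov : IsSTCovered G s t) :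
    ((∀ u v, G.Adj u v → 0 < w u v) →
      ∃ C : ℝ, 0 < C ∧ ∀ (n : ℕ) (E : Finset Pt2), E.card = n →
        ((distConfigs G w E).ncard : ℝ) ≤
          C * (n : ℝ) ^ ((4 : ℝ) / 3 * s + 2 * t)) ∧
    ((∀ u v, G.Adj u v → w u v ≠ 0) →
      ∃ C : ℝ, 0 < C ∧ ∀ (n : ℕ) (E : Finset Pt2), E.card = n →
        ((dpConfigs G w E).ncard : ℝ) ≤
          C * (n : ℝ) ^ ((4 : ℝ) / 3 * s + 2 * t)) := by
  refine ⟨fun hw => ?_, fun hw => ?_⟩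
  · exact ncard_configs_le_of_cover G w hcov (fun r p q => ‖p - q‖ = r)
      (fun u v h => card_relPairs_dist_le (hw u v h)) fun _ _ _ _ _ => card_relTriples_dist_le _ _
  · exact ncard_configs_le_of_cover G w hcov (fun r p q => ⟪p, q⟫_ℝ = r)
      (fun u v h => card_relPairs_inner_le (hw u v h))
      fun u v _ h _ => card_relTriples_inner_le (hw u v h) _
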